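/- Let I and J be (possibly infinite) sets and for each j ∈ J let F_j ∈ A[Y_i : i ∈ I]. Suppose y⁰ = (y⁰_i)_{i∈I} ∈ A^I satisfies: (1) F_j(y⁰) ∈ M for every j ∈ J; and (2) the κ-linear map κ^I → κ^J sending (z_i)_{i∈I} to ( Σ_{i∈I} ((∂F_j/∂Y_i)(y⁰) mod M) · z_i )_{j∈J} (a finite sum for each j, since each F_j involves only finitely many variables) is bijective. Then there exists a unique family y = (y_i)_{i∈I} ∈ A^I such that F_j(y) = 0 for every j ∈ J and y_i ≡ y⁰_i (mod M) for every i ∈ I. -/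

import Mathlib

noncomputable section

open IsLocalRing

namespace HenselAux

variable {A : Type} [CommRing A] {I : Type}

/-- The universal derivation. -/
def uder : Derivation A (MvPolynomial I A) (I →₀ MvPolynomial I A) :=
  MvPolynomial.mkDerivation A (fun i => Finsupp.single i 1)

lemma uder_apply (F : MvPolynomial I A) (i : I) : uder F i = MvPolynomial.pderiv i F := by
  classical
  induction F using MvPolynomial.induction_on with
  | C a => simp [uder]
  | add p q hp hq => simp [hp, hq]
  | mul_X p k hp =>
    rw [Derivation.leibniz, Derivation.leibniz, Finsupp.add_apply, Finsupp.smul_apply,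
      Finsupp.smul_apply, hp]
    congr 2
    simp [uder, MvPolynomial.pderiv_X, Finsupp.single_apply, Pi.single_apply]

/-- The gradient at a point. -/
def grad (y : I → A) (F : MvPolynomial I A) : I →₀ A :=
  (uder F).mapRange (MvPolynomial.eval y) (map_zero _)

lemma grad_apply (y : I → A) (F : MvPolynomial I A) (i : I) :
    grad y F i = MvPolynomial.eval y (MvPolynomial.pderiv i F) := by
  simp [grad, uder_apply]

lemma lc_mem (N K : Ideal A) (h : I → A) (hh : ∀ i, h i ∈ N) (v : I →₀ A) (hv : ∀ i, v i ∈ K) :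
    Finsupp.linearCombination A h v ∈ K * N := by
  rw [Finsupp.linearCombination_apply]
  exact Ideal.sum_mem _ fun i _ => Ideal.mul_mem_mul (hv i) (hh i)

lemma lc_mem' (N : Ideal A) (h : I → A) (hh : ∀ i, h i ∈ N) (v : I →₀ A) :
    Finsupp.linearCombination A h v ∈ N := by
  rw [Finsupp.linearCombination_apply]
  exact Ideal.sum_mem _ fun i _ => Ideal.mul_mem_left _ _ (hh i)

lemma taylor (N : Ideal A) (y h : I → A) (hh : ∀ i, h i ∈ N) (F : MvPolynomial I A) :
    MvPolynomial.eval (y + h) F - MvPolynomial.eval y F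
      - Finsupp.linearCombination A h (grad y F) ∈ N * N := by
  induction F using MvPolynomial.induction_on with
  | C a =>
    have : grad y (MvPolynomial.C a) = 0 := by ext i; simp [grad_apply]
    simp [this]
  | add p q hp hq =>
    have : grad y (p + q) = grad y p + grad y q := by ext i; simp [grad_apply]
    rw [this]
    convert Ideal.add_mem _ hp hq using 1
    simp only [map_add]; ring
  | mul_X p k hp =>
    have : grad y (p * MvPolynomial.X k) =
        y k • grad y p + MvPolynomial.eval y p • Finsupp.single k 1 := by
      classical
      ext i
      simp [grad_apply, MvPolynomial.pderiv_X, Finsupp.single_apply, Pi.single_apply]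
      split_ifs <;> simp [add_comm]
    rw [this]
    have e2 := Ideal.mul_mem_mul (lc_mem' N h hh (grad y p)) (hh k)
    convert Ideal.add_mem _ (Ideal.mul_mem_right (y k + h k) _ hp) e2 using 1
    simp only [map_add, map_mul, map_smul, MvPolynomial.eval_X, Finsupp.linearCombination_single,
      smul_eq_mul, Pi.add_apply]
    ring

lemma eval_congr (N : Ideal A) (y y' : I → A) (hh : ∀ i, y' i - y i ∈ N) (F : MvPolynomial I A) :
    MvPolynomial.eval y' F - MvPolynomial.eval y F ∈ N := by
  have := taylor N y (y' - y) hh F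
  rw [add_sub_cancel] at this
  have h2 := Ideal.add_mem _ (Ideal.mul_le_left this) (lc_mem' N (y' - y) hh (grad y F))
  simpa using h2

lemma step (M : Ideal A) (n : ℕ) (y0 y y' : I → A) (h0 : ∀ i, y i - y0 i ∈ M)
    (hh : ∀ i, y' i - y i ∈ M ^ (n + 1)) (F : MvPolynomial I A) :
    MvPolynomial.eval y' F - MvPolynomial.eval y F
      - Finsupp.linearCombination A (y' - y) (grad y0 F) ∈ M ^ (n + 2) := by
  have h := taylor (M ^ (n+1)) y (y' - y) hh F
  rw [add_sub_cancel, ← pow_add] at h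
  have h' := Ideal.pow_le_pow_right (show n + 2 ≤ n + 1 + (n + 1) by omega) h
  have k := lc_mem (M ^ (n+1)) M (y' - y) hh (grad y F - grad y0 F) (by
    intro i
    rw [Finsupp.sub_apply, grad_apply, grad_apply]
    exact eval_congr M _ _ h0 _)
  rw [← pow_succ'] at k
  convert Ideal.add_mem _ h' k using 1
  rw [map_sub]; ring

lemma inv_lemma {α β : Type} (M : Ideal A) (n : ℕ) (P : α → β →₀ A) (Q : β → α →₀ A)
    (a : α) (hPQ : ∀ a', (Finsupp.linearCombination A Q (P a) - Finsupp.single a 1 : α →₀ A) a' ∈ M)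
    (h : α → A) (hh : ∀ a, h a ∈ M ^ n) :
    Finsupp.linearCombination A (fun b => Finsupp.linearCombination A h (Q b)) (P a) - h a
      ∈ M ^ (n + 1) := by
  have k := lc_mem (M ^ n) M h hh _ hPQ
  rw [← pow_succ'] at k
  convert k using 1
  rw [map_sub, Finsupp.linearCombination_single, one_smul,
    Finsupp.linearCombination_linearCombination]

lemma exists_inv {κ : Type} [Field κ] {J : Type} (r : J → I →₀ κ)
    (h : Function.Bijective (fun (z : I → κ) (j : J) => Finsupp.linearCombination κ z (r j))) :
    ∃ e : I → J →₀ κ, (∀ i, Finsupp.linearCombination κ r (e i) = Finsupp.single i 1) ∧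
      ∀ j, Finsupp.linearCombination κ e (r j) = Finsupp.single j 1 := by
  have key : Function.Bijective (Finsupp.linearCombination κ r) := by
    rw [← LinearMap.dualMap_bijective_iff]
    constructor
    · intro φ ψ hφ
      have hz : ∀ φ : Module.Dual κ (I →₀ κ),
          φ = Finsupp.linearCombination κ (fun i => φ (Finsupp.single i 1)) := by
        intro φ; ext i; simp
      rw [hz φ, hz ψ]
      congr 1
      apply h.1
      funext j
      dsimp only
      rw [← hz φ, ← hz ψ]
      have := LinearMap.congr_fun hφ (Finsupp.single j 1)
      simpa [LinearMap.dualMap_apply] using this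
    · intro ψ
      obtain ⟨z, hz⟩ := h.2 (fun j => ψ (Finsupp.single j 1))
      refine ⟨Finsupp.linearCombination κ z, ?_⟩
      ext j
      simpa [LinearMap.dualMap_apply] using congrFun hz j
  choose e he using fun i : I => key.2 (Finsupp.single i 1)
  refine ⟨e, he, fun j => key.1 ?_⟩
  rw [Finsupp.linearCombination_single, one_smul, Finsupp.linearCombination_linearCombination]
  simp only [he]
  conv_rhs => rw [← Finsupp.sum_single (r j)]
  rw [Finsupp.linearCombination_apply]
  simp

lemma mapRange_lc {R S : Type} [CommRing R] [CommRing S] (f : R →+* S) {α β : Type}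
    (Q : β → α →₀ R) (v : β →₀ R) (a : α) :
    f (Finsupp.linearCombination R Q v a) =
      Finsupp.linearCombination S (fun b => (Q b).mapRange f (map_zero f))
        (v.mapRange f (map_zero f)) a := by
  induction v using Finsupp.induction_linear with
  | zero => simp
  | add p q hp hq =>
    rw [Finsupp.mapRange_add (fun _ _ => map_add f _ _)]
    simp [hp, hq]
  | single b c => simp

end HenselAux

open HenselAux in
/-- Hensel's lemma for an arbitrary set of variables over a complete local ring. -/
theorem stmt7 (A : Type) [CommRing A] [IsLocalRing A]
    [IsAdicComplete (maximalIdeal A) A]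
    (I J : Type) (F : J → MvPolynomial I A) (y0 : I → A)
    (h1 : ∀ j, MvPolynomial.eval y0 (F j) ∈ maximalIdeal A)
    (h2 : Function.Bijective (fun (z : I → ResidueField A) (j : J) =>
      ∑ᶠ i : I, residue A (MvPolynomial.eval y0 (MvPolynomial.pderiv i (F j))) * z i)) :
    ∃! y : I → A, (∀ j, MvPolynomial.eval y (F j) = 0) ∧
      ∀ i, y i - y0 i ∈ maximalIdeal A := by
  classical
  set M := maximalIdeal A with hM
  let d : J → I →₀ A := fun j => grad y0 (F j)
  have hausd : ∀ x : A, (∀ n : ℕ, x ∈ M ^ n) → x = 0 := by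
    intro x hx
    refine IsHausdorff.haus (I := M) (M := A) inferInstance x fun n => ?_
    rw [SModEq.zero]
    simpa using hx n
  obtain ⟨e', he1, he2⟩ := exists_inv (fun j => (d j).mapRange (residue A) (map_zero _)) (by
    convert h2 using 3 with z j
    rw [Finsupp.linearCombination_apply, Finsupp.sum, ← finsum_eq_sum_of_support_subset]
    · simp [d, grad_apply]
    · intro i hi
      simp only [Function.mem_support] at hi
      simp only [Finset.mem_coe, Finsupp.mem_support_iff]
      intro h0
      simp [h0] at hi)
  have hlift : ∀ v : J →₀ ResidueField A, ∃ w : J →₀ A,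
      w.mapRange (residue A) (map_zero _) = v :=
    Finsupp.mapRange_surjective _ (map_zero _) residue_surjective
  choose e he using fun i => hlift (e' i)
  have hde : ∀ j j', (Finsupp.linearCombination A e (d j) - Finsupp.single j 1 : J →₀ A) j' ∈ M := by
    intro j j'
    rw [hM, ← residue_eq_zero_iff, Finsupp.sub_apply, map_sub, mapRange_lc]
    simp only [he, he2]
    rw [Finsupp.single_apply, Finsupp.single_apply]
    split_ifs <;> simp
  have hed : ∀ i i', (Finsupp.linearCombination A d (e i) - Finsupp.single i 1 : I →₀ A) i' ∈ M := by
    intro i i'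
    rw [hM, ← residue_eq_zero_iff, Finsupp.sub_apply, map_sub, mapRange_lc]
    simp only [he, he1]
    rw [Finsupp.single_apply, Finsupp.single_apply]
    split_ifs <;> simp
  -- Newton iteration
  let T : (I → A) → (I → A) := fun y i =>
    y i - Finsupp.linearCombination A (fun j => MvPolynomial.eval y (F j)) (e i)
  let u : ℕ → I → A := fun n => T^[n] y0
  have hu0 : u 0 = y0 := rfl
  have hus : ∀ n, u (n+1) = T (u n) := fun n => Function.iterate_succ_apply' T n y0
  have hdiff : ∀ n, (∀ j, MvPolynomial.eval (u n) (F j) ∈ M ^ (n+1)) →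
      ∀ i, u (n+1) i - u n i ∈ M ^ (n+1) := by
    intro n hn i
    rw [hus]
    simp only [T, sub_sub_cancel_left]
    exact neg_mem (lc_mem' _ _ hn _)
  have hmain : ∀ n, (∀ j, MvPolynomial.eval (u n) (F j) ∈ M ^ (n+1)) ∧
      ∀ i, u n i - y0 i ∈ M := by
    intro n
    induction n with
    | zero => simpa [hu0] using h1
    | succ n ih =>
      obtain ⟨ih1, ih2⟩ := ih
      have hd := hdiff n ih1
      refine ⟨fun j => ?_, fun i => ?_⟩
      · have s := step M n y0 (u n) (u (n+1)) ih2 hd (F j)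
        have k := inv_lemma M (n+1) d e j (hde j) _ ih1
        have hneg : Finsupp.linearCombination A (u (n+1) - u n) (grad y0 (F j)) =
            - Finsupp.linearCombination A (fun i => Finsupp.linearCombination A
              (fun j => MvPolynomial.eval (u n) (F j)) (e i)) (d j) := by
          rw [hus]
          simp [Finsupp.linearCombination_apply, Finsupp.sum, T, d]
        rw [hneg] at s
        convert sub_mem s k using 1
        ring
      · have := Ideal.pow_le_self (n.succ_ne_zero) (hd i)
        simpa using add_mem this (ih2 i)
  have hcau : ∀ i, ∃ L : A, ∀ n, u n i - L ∈ M ^ n := by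
    intro i
    have hs : ∀ n k, u n i - u (n + k) i ∈ M ^ n := by
      intro n k
      induction k with
      | zero => simp
      | succ k ih =>
        have := Ideal.pow_le_pow_right (show n ≤ n + k + 1 by omega)
          (hdiff (n+k) (hmain (n+k)).1 i)
        convert sub_mem ih this using 1
        rw [← add_assoc]; ring
    obtain ⟨L, hL⟩ := IsPrecomplete.prec (I := M) (M := A) inferInstance
      (f := fun n => u n i) (by
        intro m n hmn
        obtain ⟨k, rfl⟩ := Nat.exists_eq_add_of_le hmn
        rw [SModEq.sub_mem]
        simpa using hs m k)
    refine ⟨L, fun n => ?_⟩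
    have := hL n
    rw [SModEq.sub_mem] at this
    simpa using this
  choose y hy using hcau
  refine ⟨y, ⟨fun j => hausd _ fun n => ?_, fun i => ?_⟩, ?_⟩
  · have a := eval_congr (M ^ n) y (u n) (fun i => hy i n) (F j)
    have b := Ideal.pow_le_pow_right (Nat.le_succ n) ((hmain n).1 j)
    simpa using sub_mem b a
  · have a := hy i 1
    rw [pow_one] at a
    simpa using sub_mem ((hmain 1).2 i) a
  · rintro x ⟨hx1, hx2⟩
    have hyF : ∀ j, MvPolynomial.eval y (F j) = 0 := by
      refine fun j => hausd _ fun n => ?_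
      have a := eval_congr (M ^ n) y (u n) (fun i => hy i n) (F j)
      have b := Ideal.pow_le_pow_right (Nat.le_succ n) ((hmain n).1 j)
      simpa using sub_mem b a
    have hy0 : ∀ i, y i - y0 i ∈ M := by
      intro i
      have a := hy i 1
      rw [pow_one] at a
      simpa using sub_mem ((hmain 1).2 i) a
    have hall : ∀ n : ℕ, ∀ i, x i - y i ∈ M ^ (n+1) := by
      intro n
      induction n with
      | zero =>
        intro i
        simpa using sub_mem (hx2 i) (hy0 i)
      | succ n ih =>
        intro i
        have s : ∀ j, Finsupp.linearCombination A (x - y) (d j) ∈ M ^ (n+2) := by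
          intro j
          have := step M n y0 y x hy0 ih (F j)
          rw [hx1, hyF] at this
          simpa using this
        have k := inv_lemma M (n+1) e d i (hed i) (x - y) ih
        have l := lc_mem' _ _ s (e i)
        simpa using sub_mem l k
    funext i
    exact sub_eq_zero.1 (hausd _ fun n => Ideal.pow_le_pow_right (Nat.le_succ n) (hall n i))
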